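/- arXiv:math/9911027 — 2 statements merged into one kernel-verified Lean document; each statement's English description precedes it below -/
import Mathlib

section
/- (WH-Frame Identity.) Let a, b > 0 and let g ∈ W(L^∞,L¹). Then for every bounded, measurable, compactly supported function f : ℝ → ℂ one has ∑_{m,n∈ℤ} |⟨f, E_{mb}T_{na}g⟩|² = (1/b) ∑_{k∈ℤ} ∫_ℝ conj(f(t)) f(t−k/b) G_k(t) dt, where the double sum on the left is a (finite) sum of nonnegative terms and the family on the right is unconditionally summable. -/
open MeasureTheory Complex
open scoped ENNReal

noncomputable section

/-- The Weyl–Heisenberg system element `E_{mb}T_{na}g : x ↦ e^{2πimbx} g(x - na)`. -/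
def modTrans (g : ℝ → ℂ) (a b : ℝ) (m n : ℤ) : ℝ → ℂ := fun x =>
  Complex.exp (2 * Real.pi * Complex.I * (m : ℂ) * (b : ℂ) * (x : ℂ)) * g (x - n * a)

/-- The inner product `⟨f, h⟩ = ∫ f(t) conj(h(t)) dt`. -/
def ip (f h : ℝ → ℂ) : ℂ := ∫ t : ℝ, f t * (starRingEnd ℂ) (h t)

/-- The correlation function `G_k(t) = ∑ₙ g(t-na) conj(g(t-na-k/b))`. -/
def Gk (g : ℝ → ℂ) (a b : ℝ) (k : ℤ) (t : ℝ) : ℂ :=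
  ∑' n : ℤ, g (t - n * a) * (starRingEnd ℂ) (g (t - n * a - k / b))

/-- Membership in the Wiener amalgam space `W(L^∞, L¹)`. -/
def WienerAmalgam (g : ℝ → ℂ) : Prop :=
  ∃ c : ℝ, 0 < c ∧
    (∑' n : ℤ, eLpNorm g ∞ (volume.restrict (Set.Ico ((n : ℝ) * c) (((n : ℝ) + 1) * c)))) < ⊤

section Periodization

open Set

/-- The integral over `ℝ` unfolds into integrals over one period. -/
lemma hasSum_intervalIntegral_comp_sub_mul {E : Type*} [NormedAddCommGroup E] [NormedSpace ℝ E]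
    [CompleteSpace E] {T : ℝ} (hT : 0 < T) {φ : ℝ → E} (hφ : Integrable φ) :
    HasSum (fun k : ℤ => ∫ x in (0 : ℝ)..T, φ (x - k * T)) (∫ x, φ x) := by
  have h1 : Integrable (fun x => φ (x * T)) := hφ.comp_mul_right' hT.ne'
  have h2 := h1.hasSum_intervalIntegral_comp_add_int
  rw [Measure.integral_comp_mul_right] at h2
  have h3 := (h2.const_smul T)
  rw [abs_of_pos (inv_pos.2 hT), smul_smul, mul_inv_cancel₀ hT.ne', one_smul] at h3
  rw [← (Equiv.neg ℤ).hasSum_iff]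
  refine h3.congr_fun fun k => ?_
  have h4 := intervalIntegral.smul_integral_comp_mul_right (a := 0) (b := 1)
    (fun x => φ (x + k * T)) T
  simp only [zero_mul, one_mul] at h4
  simp only [Function.comp_apply, Equiv.neg_apply, Int.cast_neg, neg_mul, sub_neg_eq_add]
  rw [← h4]
  simp only [add_mul]

/-- Unfolding as a finite sum, when only finitely many translates meet the period interval. -/
lemma integral_eq_intervalIntegral_sum {E : Type*} [NormedAddCommGroup E] [NormedSpace ℝ E]
    [CompleteSpace E] {T : ℝ} (hT : 0 < T) {φ : ℝ → E} (hφ : Integrable φ) (S : Finset ℤ)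
    (hS : ∀ k ∉ S, ∀ x ∈ Icc 0 T, φ (x - k * T) = 0) :
    ∫ x, φ x = ∫ x in (0 : ℝ)..T, ∑ k ∈ S, φ (x - k * T) := by
  rw [← (hasSum_intervalIntegral_comp_sub_mul hT hφ).tsum_eq, tsum_eq_sum (s := S),
    intervalIntegral.integral_finsetSum]
  · intro k _
    exact (hφ.comp_sub_right _).intervalIntegrable
  · intro k hk
    rw [intervalIntegral.integral_congr (g := fun _ => 0)]
    · simp
    · intro x hx
      rw [uIcc_of_le hT.le] at hx
      exact hS k hk x hx

lemma abs_mul_period_gt_of_notMem {T R : ℝ} (hT : 0 < T) {M : ℕ} (hM : 2 * R + T ≤ M * T)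
    {k : ℤ} (hk : k ∉ Finset.Icc (-(M : ℤ)) M) {x : ℝ} (hx : |x| ≤ R + T) :
    R < |x - k * T| := by
  rw [Finset.mem_Icc, ← abs_le, not_le] at hk
  have h1 : (M : ℝ) + 1 ≤ |(k : ℝ)| := by exact_mod_cast hk
  have h2 : |(k : ℝ) * T| = |(k : ℝ)| * T := by rw [abs_mul, abs_of_pos hT]
  have h3 := abs_sub_abs_le_abs_sub ((k : ℝ) * T) x
  rw [abs_sub_comm] at h3
  nlinarith

/-- Plancherel for the `T`-periodization of a compactly supported `h ∈ L²(ℝ)`. -/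
lemma hasSum_sq_norm_integral_exp {T R : ℝ} (hT : 0 < T) (hR : 0 ≤ R) {M : ℕ}
    (hM : 2 * R + T ≤ M * T) {h : ℝ → ℂ} (hh : MemLp h 2) (h0 : ∀ t, R < |t| → h t = 0) :
    ∃ V : ℝ, HasSum (fun m : ℤ =>
        ‖∫ t, h t * Complex.exp (-(2 * Real.pi * Complex.I * m * (T⁻¹ : ℝ) * t))‖ ^ 2) V ∧
      (V : ℂ) = T * ∑ k ∈ Finset.Icc (-(M : ℤ)) M,
        ∫ t, (starRingEnd ℂ) (h t) * h (t - k * T) := by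
  set S := Finset.Icc (-(M : ℤ)) M with hS
  set F : ℝ → ℂ := fun x => ∑ k ∈ S, h (x - k * T) with hF
  have hFL : MemLp F 2 := memLp_finsetSum S fun k _ =>
    hh.comp_measurePreserving (measurePreserving_sub_right volume _)
  have hFt : ∀ x, |x| ≤ R + T → F x = ∑' k : ℤ, h (x - k * T) := fun x hx =>
    (tsum_eq_sum fun k hk => h0 _ (abs_mul_period_gt_of_notMem hT hM hk hx)).symm
  have habs : ∀ x ∈ Icc 0 T, |x| ≤ R + T := fun x hx => by
    rw [abs_of_nonneg hx.1]; linarith [hx.2]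
  have hint : Integrable h := by
    have h1 : h = (Icc (-R) R).indicator h := by
      ext t
      by_cases ht : t ∈ Icc (-R) R
      · simp [ht]
      · rw [indicator_of_notMem ht]
        refine h0 t ?_
        rwa [mem_Icc, ← abs_le, not_le] at ht
    rw [h1, integrable_indicator_iff measurableSet_Icc]
    exact (hh.restrict _).integrable (by norm_num)
  have hcoef : ∀ m : ℤ, ∫ t, h t * Complex.exp (-(2 * Real.pi * Complex.I * m * (T⁻¹ : ℝ) * t))
      = T * fourierCoeffOn hT F m := by
    intro m
    have hTc : (T : ℂ) ≠ 0 := by exact_mod_cast hT.ne'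
    have hie : Integrable fun t : ℝ =>
        h t * Complex.exp (-(2 * Real.pi * Complex.I * m * (T⁻¹ : ℝ) * t)) := by
      refine hint.mul_bdd (c := 1) (by fun_prop) (.of_forall fun t => ?_)
      rw [Complex.norm_exp]
      simp
    rw [integral_eq_intervalIntegral_sum hT hie S, fourierCoeffOn_eq_integral]
    · rw [Complex.real_smul, sub_zero, ← mul_assoc]
      push_cast
      rw [mul_one_div_cancel hTc, one_mul]
      congr 1
      ext x
      rw [fourier_coe_apply, hF, smul_eq_mul, Finset.mul_sum]
      refine Finset.sum_congr rfl fun k _ => ?_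
      rw [mul_comm]
      congr 1
      rw [Complex.exp_eq_exp_iff_exists_int]
      refine ⟨m * k, ?_⟩
      push_cast
      field_simp
      ring
    · intro k hk x hx
      rw [h0 _ (abs_mul_period_gt_of_notMem hT hM hk (habs x hx)), zero_mul]
  refine ⟨T * ∫ x in (0 : ℝ)..T, ‖F x‖ ^ 2, ?_, ?_⟩
  · have := (hasSum_sq_fourierCoeffOn hT (hFL.restrict _)).mul_left (T ^ 2)
    rw [sub_zero, smul_eq_mul, ← mul_assoc, sq T, mul_assoc T, mul_inv_cancel₀ hT.ne', mul_one,
      ← sq T] at this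
    refine this.congr_fun fun m => ?_
    rw [hcoef, norm_mul, mul_pow, Complex.norm_real, Real.norm_of_nonneg hT.le]
  · have hprod : Integrable fun t => (starRingEnd ℂ) (h t) * F t :=
      MemLp.integrable_mul (p := 2) (q := 2) hh.star hFL
    have e1 : ∑ k ∈ S, ∫ t, (starRingEnd ℂ) (h t) * h (t - k * T) =
        ∫ t, (starRingEnd ℂ) (h t) * F t := by
      simp only [hF, Finset.mul_sum]
      rw [integral_finsetSum]
      intro k _
      exact MemLp.integrable_mul (p := 2) (q := 2) hh.star
        (hh.comp_measurePreserving (measurePreserving_sub_right volume _))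
    rw [e1, integral_eq_intervalIntegral_sum hT hprod S]
    · push_cast
      rw [← intervalIntegral.integral_ofReal]
      congr 1
      refine intervalIntegral.integral_congr fun x hx => ?_
      rw [uIcc_of_le hT.le] at hx
      have e2 : ∀ k ∈ S, (starRingEnd ℂ) (h (x - k * T)) * F (x - k * T) =
          (starRingEnd ℂ) (h (x - k * T)) * F x := by
        intro k _
        by_cases hk : R < |x - k * T|
        · simp [h0 _ hk]
        · rw [hFt x (habs x hx), hFt (x - k * T) (by linarith),
            ← (Equiv.addLeft k).tsum_eq (fun j : ℤ => h (x - j * T))]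
          congr 2
          ext j
          congr 1
          simp
          ring
      rw [Finset.sum_congr rfl e2, ← Finset.sum_mul, ← map_sum]
      change _ = (starRingEnd ℂ) (F x) * F x
      rw [Complex.conj_mul']
      push_cast
      rfl
    · intro k hk x hx
      rw [h0 _ (abs_mul_period_gt_of_notMem hT hM hk (habs x hx))]
      simp

lemma exists_nat_le_mul_period {T : ℝ} (hT : 0 < T) (R : ℝ) : ∃ M : ℕ, 2 * R + T ≤ M * T := by
  obtain ⟨M, hM⟩ := exists_nat_ge ((2 * R + T) / T)
  exact ⟨M, (div_le_iff₀ hT).1 hM⟩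

/-- The translates of an integrable function have summable integrals over a bounded set. -/
lemma summable_integral_indicator_translates {a R : ℝ} (ha : 0 < a) (hR : 0 ≤ R) {q : ℝ → ℝ}
    (hq : Integrable q) (hq0 : ∀ t, 0 ≤ q t) :
    Summable fun n : ℤ => ∫ t, (Icc (-R) R).indicator (fun t => q (t - n * a)) t := by
  obtain ⟨M, hM⟩ := exists_nat_le_mul_period ha R
  have hs := (hasSum_intervalIntegral_comp_sub_mul ha hq).summable
  have hs' : Summable fun n : ℤ => ∑ j ∈ Finset.Icc (-(M : ℤ)) M,
      ∫ x in (0 : ℝ)..a, q (x - (j + n : ℤ) * a) :=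
    summable_sum fun j _ => hs.comp_injective (add_right_injective j)
  refine Summable.of_nonneg_of_le (fun n => integral_nonneg fun t =>
    indicator_nonneg (fun t _ => hq0 _) t) (fun n => ?_) hs'
  have hqn : Integrable fun t => q (t - n * a) := hq.comp_sub_right _
  have hφ : Integrable ((Icc (-R) R).indicator fun t => q (t - n * a)) :=
    hqn.indicator measurableSet_Icc
  rw [integral_eq_intervalIntegral_sum ha hφ (Finset.Icc (-(M : ℤ)) M),
    intervalIntegral.integral_finsetSum]
  · refine Finset.sum_le_sum fun j _ => ?_
    refine intervalIntegral.integral_mono_on ha.le (hφ.comp_sub_right _).intervalIntegrable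
      (hq.comp_sub_right _).intervalIntegrable fun x _ => ?_
    refine (indicator_le_self' (fun t _ => hq0 _) _).trans (le_of_eq ?_)
    congr 1
    push_cast
    ring
  · intro j _
    exact (hφ.comp_sub_right _).intervalIntegrable
  · intro k hk x hx
    refine indicator_of_notMem (fun hmem => ?_) _
    refine (abs_mul_period_gt_of_notMem ha hM hk (x := x) ?_).not_ge (abs_le.2 hmem)
    rw [abs_of_nonneg hx.1]
    linarith [hx.2]

/-- The Wiener amalgam space is contained in `L²`. -/
lemma WienerAmalgam.memLp_two {g : ℝ → ℂ} (hg : Measurable g) (h : WienerAmalgam g) :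
    MemLp g 2 := by
  obtain ⟨c, hc, hsum⟩ := h
  set A : ℤ → ℝ≥0∞ := fun n =>
    eLpNorm g ∞ (volume.restrict (Ico ((n : ℝ) * c) (((n : ℝ) + 1) * c))) with hA
  refine ⟨hg.aestronglyMeasurable, ?_⟩
  rw [eLpNorm_lt_top_iff_lintegral_rpow_enorm_lt_top (by norm_num) (by norm_num)]
  have hU : (⋃ n : ℤ, Ico ((n : ℝ) * c) (((n : ℝ) + 1) * c)) = univ := by
    simpa [add_mul] using iUnion_Ico_zsmul hc
  have hpiece : ∀ n : ℤ, ∫⁻ t in Ico ((n : ℝ) * c) (((n : ℝ) + 1) * c), ‖g t‖ₑ ^ (2 : ℝ) ≤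
      ((∑' n, A n) * ENNReal.ofReal c) * A n := by
    intro n
    calc ∫⁻ t in Ico ((n : ℝ) * c) (((n : ℝ) + 1) * c), ‖g t‖ₑ ^ (2 : ℝ)
        ≤ ∫⁻ t in Ico ((n : ℝ) * c) (((n : ℝ) + 1) * c), A n ^ (2 : ℝ) := by
          refine lintegral_mono_ae ?_
          filter_upwards [ae_le_eLpNormEssSup (f := g) (μ := volume.restrict
            (Ico ((n : ℝ) * c) (((n : ℝ) + 1) * c)))] with t ht
          rw [← eLpNorm_exponent_top] at ht
          gcongr
      _ = A n * ENNReal.ofReal c * A n := by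
          rw [setLIntegral_const, Real.volume_Ico, add_mul, one_mul, add_sub_cancel_left,
            ENNReal.rpow_two]
          ring
      _ ≤ _ := by
          gcongr
          exact ENNReal.le_tsum n
  calc ∫⁻ t, ‖g t‖ₑ ^ (2 : ℝ≥0∞).toReal
      = ∫⁻ t in ⋃ n : ℤ, Ico ((n : ℝ) * c) (((n : ℝ) + 1) * c), ‖g t‖ₑ ^ (2 : ℝ) := by
        rw [hU]; simp
    _ ≤ ∑' n : ℤ, ∫⁻ t in Ico ((n : ℝ) * c) (((n : ℝ) + 1) * c), ‖g t‖ₑ ^ (2 : ℝ) :=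
        lintegral_iUnion_le _ _
    _ ≤ ∑' n : ℤ, ((∑' n, A n) * ENNReal.ofReal c) * A n := ENNReal.tsum_le_tsum hpiece
    _ < ⊤ := by
        rw [ENNReal.tsum_mul_left]
        exact ENNReal.mul_lt_top (ENNReal.mul_lt_top hsum ENNReal.ofReal_lt_top) hsum

/-- Integrating the correlation function against a bounded compactly supported weight may be done
termwise. -/
lemma hasSum_integral_mul_Gk {a b R C : ℝ} (ha : 0 < a) (hR : 0 ≤ R) {g : ℝ → ℂ}
    (hg : MemLp g 2) {w : ℝ → ℂ} (hw : Measurable w) (hwC : ∀ t, ‖w t‖ ≤ C)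
    (hw0 : ∀ t, R < |t| → w t = 0) (k : ℤ) :
    HasSum (fun n : ℤ => ∫ t, w t * (g (t - n * a) * (starRingEnd ℂ) (g (t - n * a - k / b))))
      (∫ t, w t * Gk g a b k t) := by
  have hC : 0 ≤ C := (norm_nonneg _).trans (hwC 0)
  have hq : Integrable fun t => ‖g t‖ ^ 2 := hg.integrable_norm_pow (p := 2) (by norm_num)
  have hqk : Integrable fun t => ‖g (t - k / b)‖ ^ 2 := hq.comp_sub_right _
  have hs1 := summable_integral_indicator_translates ha hR hq fun t => sq_nonneg _
  have hs2 := summable_integral_indicator_translates ha hR hqk fun t => sq_nonneg _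
  have hgn : ∀ s : ℝ, MemLp (fun t => g (t - s)) 2 := fun s =>
    hg.comp_measurePreserving (measurePreserving_sub_right volume s)
  have hB : ∀ n : ℤ, Integrable fun t =>
      w t * (g (t - n * a) * (starRingEnd ℂ) (g (t - n * a - k / b))) := by
    intro n
    refine Integrable.bdd_mul (c := C) ?_ hw.aestronglyMeasurable (.of_forall hwC)
    refine MemLp.integrable_mul (p := 2) (q := 2) (hgn _) ?_
    simp only [sub_sub]
    exact (hgn (n * a + k / b)).star
  have hsum : Summable fun n : ℤ =>
      ∫ t, ‖w t * (g (t - n * a) * (starRingEnd ℂ) (g (t - n * a - k / b)))‖ := by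
    refine Summable.of_nonneg_of_le (fun n => integral_nonneg fun t => norm_nonneg _) (fun n => ?_)
      ((hs1.add hs2).mul_left C)
    have hi1 : Integrable ((Icc (-R) R).indicator fun t => ‖g (t - n * a)‖ ^ 2) :=
      (hq.comp_sub_right (n * a : ℝ)).indicator measurableSet_Icc
    have hi2 : Integrable ((Icc (-R) R).indicator fun t => ‖g (t - n * a - k / b)‖ ^ 2) :=
      (hqk.comp_sub_right (n * a : ℝ)).indicator measurableSet_Icc
    rw [← integral_add hi1 hi2, ← integral_const_mul]
    refine integral_mono (hB n).norm ((hi1.add hi2).const_mul C) fun t => ?_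
    by_cases ht : t ∈ Icc (-R) R
    · simp only [indicator_of_mem ht, norm_mul, RCLike.norm_conj]
      refine mul_le_mul (hwC t) ?_ (by positivity) hC
      nlinarith [sq_nonneg (‖g (t - n * a)‖ - ‖g (t - n * a - k / b)‖),
        sq_nonneg (‖g (t - n * a)‖), sq_nonneg (‖g (t - n * a - k / b)‖)]
    · simp only [indicator_of_notMem ht]
      rw [mem_Icc, ← abs_le, not_le] at ht
      simp [hw0 t ht]
  have := hasSum_integral_of_summable_integral_norm hB hsum
  simpa only [Gk, tsum_mul_left] using this

end Periodization

/-- WH-Frame Identity: for `g ∈ W(L^∞,L¹)` and any bounded, measurable,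
compactly supported `f`, the frame energy `∑_{m,n} |⟨f, E_{mb}T_{na}g⟩|²` is finite and
equals `(1/b) ∑ₖ ∫ conj(f(t)) f(t-k/b) G_k(t) dt`, the right-hand family being
unconditionally summable. -/
theorem stmt_4 (a b : ℝ) (ha : 0 < a) (hb : 0 < b) (g : ℝ → ℂ) (hmg : Measurable g)
    (hgW : WienerAmalgam g) (f : ℝ → ℂ) (hmf : Measurable f)
    (hbd : ∃ C : ℝ, ∀ t : ℝ, ‖f t‖ ≤ C) (hsupp : HasCompactSupport f) :
    Summable (fun p : ℤ × ℤ => ‖ip f (modTrans g a b p.1 p.2)‖ ^ 2) ∧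
    HasSum
      (fun k : ℤ =>
        (1 / (b : ℂ)) * ∫ t : ℝ, (starRingEnd ℂ) (f t) * f (t - k / b) * Gk g a b k t)
      (((∑' p : ℤ × ℤ, ‖ip f (modTrans g a b p.1 p.2)‖ ^ 2 : ℝ) : ℂ)) := by
  have hg := hgW.memLp_two hmg
  obtain ⟨C, hC⟩ := hbd
  have hC0 : 0 ≤ C := (norm_nonneg _).trans (hC 0)
  obtain ⟨R, hR, hfR⟩ : ∃ R : ℝ, 0 ≤ R ∧ ∀ t, R < |t| → f t = 0 := by
    obtain ⟨R, hR⟩ := hsupp.isCompact.isBounded.exists_norm_le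
    refine ⟨max R 0, le_max_right _ _, fun t ht => ?_⟩
    by_contra hne
    exact ((le_max_left R 0).trans_lt ht).not_ge (hR t (subset_tsupport f hne))
  have hT : 0 < b⁻¹ := inv_pos.2 hb
  obtain ⟨M, hM⟩ := exists_nat_le_mul_period hT R
  set S := Finset.Icc (-(M : ℤ)) M with hS
  have hmem : ∀ n : ℤ, MemLp (fun t => f t * (starRingEnd ℂ) (g (t - n * a))) 2 := fun n => by
    have h1 : MemLp (fun t => (starRingEnd ℂ) (g (t - n * a))) 2 :=
      (hg.comp_measurePreserving (measurePreserving_sub_right volume (n * a : ℝ))).star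
    refine MemLp.of_le_mul (c := C) h1 (hmf.aestronglyMeasurable.mul h1.1) (.of_forall fun t => ?_)
    rw [norm_mul]
    gcongr
    exact hC t
  choose V hV hVeq using fun n : ℤ => hasSum_sq_norm_integral_exp hT hR hM (hmem n)
    (fun t ht => by simp [hfR t ht])
  have hip : ∀ m n : ℤ, ip f (modTrans g a b m n) =
      ∫ t, f t * (starRingEnd ℂ) (g (t - n * a)) *
        Complex.exp (-(2 * Real.pi * Complex.I * m * (b⁻¹⁻¹ : ℝ) * t)) := by
    intro m n
    refine integral_congr_ae (.of_forall fun t => ?_)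
    simp only [modTrans, map_mul, ← Complex.exp_conj, inv_inv]
    simp [map_ofNat (starRingEnd ℂ) 2]
    ring
  simp only [← hip] at hV
  have hterm : ∀ k : ℤ, HasSum (fun n : ℤ => ∫ t, (starRingEnd ℂ) (f t) * f (t - k / b) *
      (g (t - n * a) * (starRingEnd ℂ) (g (t - n * a - k / b))))
      (∫ t, (starRingEnd ℂ) (f t) * f (t - k / b) * Gk g a b k t) := fun k =>
    hasSum_integral_mul_Gk (C := C * C) ha hR hg
      (by fun_prop)
      (fun t => by
        rw [norm_mul, RCLike.norm_conj]
        exact mul_le_mul (hC t) (hC _) (norm_nonneg _) hC0)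
      (fun t ht => by simp [hfR t ht]) k
  have hVsum : HasSum (fun n => (V n : ℂ)) (∑ k ∈ S, (1 / (b : ℂ)) *
      ∫ t, (starRingEnd ℂ) (f t) * f (t - k / b) * Gk g a b k t) := by
    refine (hasSum_sum fun k _ => (hterm k).mul_left (1 / (b : ℂ))).congr_fun fun n => ?_
    rw [hVeq, ← Finset.mul_sum]
    push_cast
    rw [one_div]
    congr 1
    refine Finset.sum_congr rfl fun k _ => integral_congr_ae (.of_forall fun t => ?_)
    simp only [map_mul, Complex.conj_conj, div_eq_mul_inv]
    rw [sub_right_comm t (k * b⁻¹) (n * a)]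
    ring
  have hVs : Summable V := by
    have := hVsum.summable
    exact_mod_cast this
  have hsum : Summable (fun p : ℤ × ℤ => ‖ip f (modTrans g a b p.2 p.1)‖ ^ 2) := by
    rw [summable_prod_of_nonneg fun _ => sq_nonneg _]
    exact ⟨fun n => (hV n).summable, by simpa only [(hV _).tsum_eq] using hVs⟩
  refine ⟨hsum.prod_symm, ?_⟩
  have htot : ((∑' p : ℤ × ℤ, ‖ip f (modTrans g a b p.1 p.2)‖ ^ 2 : ℝ) : ℂ) =
      ∑ k ∈ S, (1 / (b : ℂ)) *
        ∫ t, (starRingEnd ℂ) (f t) * f (t - k / b) * Gk g a b k t := by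
    rw [← hVsum.tsum_eq, ← Complex.ofReal_tsum, ← (Equiv.prodComm ℤ ℤ).tsum_eq]
    congr 1
    refine (hsum.tsum_prod' fun n => (hV n).summable).trans ?_
    exact tsum_congr fun n => (hV n).tsum_eq
  rw [htot]
  refine hasSum_sum_of_ne_finset_zero fun k hk => ?_
  rw [integral_eq_zero_of_ae (.of_forall fun t => ?_), mul_zero]
  by_cases ht : R < |t|
  · simp [hfR t ht]
  · have := abs_mul_period_gt_of_notMem hT hM hk (x := t) (by linarith)
    rw [← div_eq_mul_inv] at this
    simp [hfR _ this]
end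
end

section
/- If g ∈ W(L^∞,L¹), then for all a, b > 0 the pair (g,a,b) satisfies the CC-condition: there is a constant B (depending on a, b and g) such that ∑_{k∈ℤ} |G_k(t)| ≤ B for almost every t ∈ ℝ, where G_k(t) = ∑_{n∈ℤ} g(t−na) conj(g(t−na−k/b)) and these series converge absolutely for almost every t. -/
open MeasureTheory Complex
open scoped ENNReal

noncomputable section

/-- A window of length `c` contains at most `K` points of a lattice of step `d` when `c < K * d`,
so sampling a step function along the lattice costs at most a factor `K`. -/
lemma tsum_floor_sub_mul_le (M : ℤ → ℝ≥0∞) {c d : ℝ} (hc : 0 < c) (hd : 0 < d) {K : ℕ}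
    [NeZero K] (hK : c < K * d) (t : ℝ) :
    ∑' j : ℤ, M ⌊(t - j * d) / c⌋ ≤ K * ∑' m : ℤ, M m := by
  have h_inj : Function.Injective
      (fun j : ℤ => ((j : ZMod K), ⌊(t - j * d) / c⌋)) := by
    intro i j hij
    obtain ⟨h1, h2⟩ := Prod.mk.inj hij
    have hdvd : (K : ℤ) ∣ j - i := (ZMod.intCast_eq_intCast_iff_dvd_sub i j K).1 h1
    have h3 := Int.abs_sub_lt_one_of_floor_eq_floor h2
    rw [← sub_div, abs_div, abs_of_pos hc, div_lt_one hc] at h3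
    have h4 : (t - i * d) - (t - j * d) = (j - i) * d := by ring
    rw [h4, abs_mul, abs_of_pos hd] at h3
    have h5 : |((j : ℝ) - i)| < K := lt_of_mul_lt_mul_right (h3.trans hK) hd.le
    have h6 : |j - i| < (K : ℤ) := by exact_mod_cast h5
    have := Int.eq_zero_of_abs_lt_dvd hdvd h6
    omega
  calc ∑' j : ℤ, M ⌊(t - j * d) / c⌋
      ≤ ∑' p : ZMod K × ℤ, M p.2 :=
        ENNReal.tsum_comp_le_tsum_of_injective h_inj (fun p => M p.2)
    _ = K * ∑' m : ℤ, M m := by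
        rw [ENNReal.tsum_prod (f := fun (_ : ZMod K) m => M m)]
        simp [tsum_fintype, ZMod.card]

/-- Almost everywhere, a function is bounded by its essential supremum on the window
`[nc, (n+1)c)` containing the point. -/
lemma ae_enorm_le_eLpNorm_window (g : ℝ → ℂ) {c : ℝ} (hc : 0 < c) :
    ∀ᵐ s : ℝ, ‖g s‖ₑ ≤ eLpNorm g ∞
      (volume.restrict (Set.Ico ((⌊s / c⌋ : ℝ) * c) (((⌊s / c⌋ : ℝ) + 1) * c))) := by
  have h : ∀ n : ℤ, ∀ᵐ s : ℝ, s ∈ Set.Ico ((n : ℝ) * c) (((n : ℝ) + 1) * c) →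
      ‖g s‖ₑ ≤ eLpNorm g ∞ (volume.restrict (Set.Ico ((n : ℝ) * c) (((n : ℝ) + 1) * c))) := by
    intro n
    rw [← ae_restrict_iff' measurableSet_Ico, eLpNorm_exponent_top]
    exact ae_le_eLpNormEssSup
  filter_upwards [ae_all_iff.2 h] with s hs
  exact hs _ ⟨(le_div_iff₀ hc).1 (Int.floor_le _), (div_lt_iff₀ hc).1 (Int.lt_floor_add_one _)⟩

/-- If `g ∈ W(L^∞,L¹)`, then for all `a, b > 0` the pair `(g,a,b)`
satisfies the CC-condition: a.e. the series defining each `G_k(t)` converges absolutely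
and there is a constant `B` with `∑ₖ |G_k(t)| ≤ B` a.e. -/
theorem stmt_19 (g : ℝ → ℂ) (hmg : Measurable g) (hgW : WienerAmalgam g) :
    ∀ a b : ℝ, 0 < a → 0 < b →
      ∃ B : ℝ, ∀ᵐ t : ℝ,
        (∀ k : ℤ, Summable (fun n : ℤ => ‖g (t - n * a)‖ * ‖g (t - n * a - k / b)‖)) ∧
        Summable (fun k : ℤ => ‖Gk g a b k t‖) ∧
        (∑' k : ℤ, ‖Gk g a b k t‖) ≤ B := by
  intro a b ha hb
  obtain ⟨c, hc, hS⟩ := hgW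
  set M : ℤ → ℝ≥0∞ := fun n =>
    eLpNorm g ∞ (volume.restrict (Set.Ico ((n : ℝ) * c) (((n : ℝ) + 1) * c))) with hM
  have h_exists : ∀ d : ℝ, 0 < d → ∃ K : ℕ, ∀ t : ℝ,
      ∑' j : ℤ, M ⌊(t - j * d) / c⌋ ≤ K * ∑' m : ℤ, M m := by
    intro d hd
    obtain ⟨K, hK⟩ := exists_nat_gt (c / d)
    have hKpos : (0 : ℝ) < K := (div_pos hc hd).trans hK
    have : NeZero K := ⟨by rintro rfl; simp at hKpos⟩
    exact ⟨K, tsum_floor_sub_mul_le M hc hd ((div_lt_iff₀ hd).1 hK)⟩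
  obtain ⟨K, hK⟩ := h_exists a ha
  obtain ⟨L, hL⟩ := h_exists (1 / b) (by positivity)
  set S := ∑' m : ℤ, M m
  have hR : (K * S) * (L * S) ≠ ⊤ :=
    ENNReal.mul_ne_top (ENNReal.mul_ne_top (ENNReal.natCast_ne_top K) hS.ne)
      (ENNReal.mul_ne_top (ENNReal.natCast_ne_top L) hS.ne)
  refine ⟨((K * S) * (L * S)).toReal, ?_⟩
  have h_ae : ∀ x : ℝ, ∀ᵐ t : ℝ, ‖g (t - x)‖ₑ ≤ M ⌊(t - x) / c⌋ := fun x =>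
    (measurePreserving_sub_right volume x).quasiMeasurePreserving.ae
      (ae_enorm_le_eLpNorm_window g hc)
  filter_upwards [ae_all_iff.2 fun n : ℤ => h_ae (n * a),
    ae_all_iff.2 fun n : ℤ => ae_all_iff.2 fun k : ℤ => h_ae (n * a + k / b)] with t h1 h2
  have h_sum : ∑' k : ℤ, ∑' n : ℤ, ‖g (t - n * a)‖ₑ * ‖g (t - n * a - k / b)‖ₑ
      ≤ (K * S) * (L * S) := by
    rw [ENNReal.tsum_comm]
    calc ∑' n : ℤ, ∑' k : ℤ, ‖g (t - n * a)‖ₑ * ‖g (t - n * a - k / b)‖ₑ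
        ≤ ∑' n : ℤ, ∑' k : ℤ, M ⌊(t - n * a) / c⌋ * M ⌊(t - n * a - k * (1 / b)) / c⌋ := by
          gcongr with n k
          · exact h1 n
          · simpa only [mul_one_div, sub_sub] using h2 n k
      _ ≤ ∑' n : ℤ, M ⌊(t - n * a) / c⌋ * (L * S) := by
          gcongr with n
          rw [ENNReal.tsum_mul_left]
          gcongr
          exact hL _
      _ ≤ (K * S) * (L * S) := by
          rw [ENNReal.tsum_mul_right]
          gcongr
          exact hK t
  have h_summable : ∀ k : ℤ,
      Summable (fun n : ℤ => ‖g (t - n * a)‖ * ‖g (t - n * a - k / b)‖) := by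
    intro k
    simpa using ENNReal.summable_toReal
      (ne_top_of_le_ne_top hR ((ENNReal.le_tsum k).trans h_sum))
  have h_Gk : ∑' k : ℤ, ‖Gk g a b k t‖ₑ ≤ (K * S) * (L * S) := by
    refine (ENNReal.tsum_le_tsum fun k => ?_).trans h_sum
    refine enorm_tsum_le_tsum_enorm.trans_eq ?_
    simp [enorm_mul]
  have h_top := ne_top_of_le_ne_top hR h_Gk
  refine ⟨h_summable, by simpa using ENNReal.summable_toReal h_top, ?_⟩
  have := ENNReal.toReal_mono hR h_Gk
  rw [ENNReal.tsum_toReal_eq fun k => enorm_ne_top] at this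
  simpa only [toReal_enorm] using this
end
end
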